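/- arXiv:2303.04949 — 5 statements merged into one kernel-verified Lean document; each statement's English description precedes it below -/
import Mathlib

section
/- Let n ≥ 1, let Ω = I_n ⊗ [[0,1],[-1,0]], let S be a real symplectic 2n×2n matrix, let ν₁,…,ν_n be reals with each ν_j > 1, let D := diag(ν₁,…,ν_n) ⊗ I₂, E := diag(√(1-ν₁⁻²),…,√(1-ν_n⁻²)) ⊗ I₂, V := SᵀDS and R := Sᵀ E S⁻ᵀ. Then the real symmetric matrix Ω V⁻¹ Ωᵀ − (I − R)V is positive definite; that is, (I − R)V < Ω V⁻¹ Ωᵀ in the positive-definite order. -/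
open Matrix
open scoped Kronecker

noncomputable section

/-- The `2n × 2n` standard symplectic form `Ω = I_n ⊗ [[0,1],[-1,0]]`. -/
def Omega (n : ℕ) : Matrix (Fin n × Fin 2) (Fin n × Fin 2) ℝ :=
  (1 : Matrix (Fin n) (Fin n) ℝ) ⊗ₖ !![(0 : ℝ), 1; -1, 0]

theorem Omega_mul_transpose (n : ℕ) : Omega n * (Omega n)ᵀ = 1 := by
  have h : !![(0 : ℝ), 1; -1, 0] * !![(0 : ℝ), 1; -1, 0]ᵀ = 1 := by
    ext i j
    fin_cases i <;> fin_cases j <;> simp [Matrix.mul_apply]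
  rw [Omega, ← Matrix.kroneckerMap_transpose, ← Matrix.mul_kronecker_mul, h]
  simp

theorem Omega_commute_diagonal_kronecker (n : ℕ) (d : Fin n → ℝ) :
    Omega n * (Matrix.diagonal d ⊗ₖ (1 : Matrix (Fin 2) (Fin 2) ℝ)) =
      (Matrix.diagonal d ⊗ₖ (1 : Matrix (Fin 2) (Fin 2) ℝ)) * Omega n := by
  simp only [Omega, ← Matrix.mul_kronecker_mul, one_mul, mul_one]

theorem diagonal_kronecker_one_posDef {n : ℕ} {d : Fin n → ℝ} (hd : ∀ j, 0 < d j) :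
    (Matrix.diagonal d ⊗ₖ (1 : Matrix (Fin 2) (Fin 2) ℝ)).PosDef := by
  rw [← Matrix.diagonal_one, Matrix.diagonal_kronecker_diagonal]
  exact Matrix.PosDef.diagonal fun p => by simpa using hd p.1

theorem inv_sub_one_sub_sqrt_mul_pos {x : ℝ} (hx : 1 < x) :
    0 < x⁻¹ - (1 - Real.sqrt (1 - (x ^ 2)⁻¹)) * x := by
  have hx0 : 0 < x := by linarith
  have hinv : (x ^ 2)⁻¹ < 1 := inv_lt_one_of_one_lt₀ (by nlinarith)
  have hinv0 : 0 < (x ^ 2)⁻¹ := by positivity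
  set s := Real.sqrt (1 - (x ^ 2)⁻¹) with hs
  have hs0 : 0 < s := Real.sqrt_pos.2 (by linarith)
  have hsq : s ^ 2 = 1 - (x ^ 2)⁻¹ := Real.sq_sqrt (by linarith)
  have hs1 : s < 1 := by nlinarith
  have hxinv : x⁻¹ = (1 - s ^ 2) * x := by
    rw [hsq]
    field_simp
    ring
  have hpos : 0 < x * (s * (1 - s)) := mul_pos hx0 (mul_pos hs0 (by linarith))
  rw [hxinv]
  linarith

/-- With `V = SᵀDS` in Williamson form (`ν_j > 1`) and `R = Sᵀ E S⁻ᵀ` where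
`E = √(I - D⁻²)`, the matrix `Ω V⁻¹ Ωᵀ − (I − R) V` is positive definite. -/
theorem posDef_omega_inv_conj_sub (n : ℕ) (hn : 1 ≤ n)
    (S : Matrix (Fin n × Fin 2) (Fin n × Fin 2) ℝ)
    (hS : Sᵀ * Omega n * S = Omega n)
    (ν : Fin n → ℝ) (hν : ∀ j, 1 < ν j)
    (D E V R : Matrix (Fin n × Fin 2) (Fin n × Fin 2) ℝ)
    (hD : D = (Matrix.diagonal ν) ⊗ₖ (1 : Matrix (Fin 2) (Fin 2) ℝ))
    (hE : E = (Matrix.diagonal fun j => Real.sqrt (1 - ((ν j) ^ 2)⁻¹)) ⊗ₖ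
      (1 : Matrix (Fin 2) (Fin 2) ℝ))
    (hV : V = Sᵀ * D * S)
    (hR : R = Sᵀ * E * (S⁻¹)ᵀ) :
    (Omega n * V⁻¹ * (Omega n)ᵀ - (1 - R) * V).PosDef := by
  have hΩ := Omega_mul_transpose n
  have hΩdet : IsUnit (Omega n).det :=
    (Matrix.isUnit_iff_isUnit_det _).1 (IsUnit.of_mul_eq_one _ hΩ)
  have hSdet : IsUnit S.det := by
    rw [← hS, Matrix.det_mul] at hΩdet
    exact isUnit_of_mul_isUnit_right hΩdet
  have hS1 : S * S⁻¹ = 1 := Matrix.mul_nonsing_inv S hSdet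
  have hΩS : Omega n * S⁻¹ = Sᵀ * Omega n := by
    conv_lhs => rw [← hS]
    rw [Matrix.mul_assoc, hS1, Matrix.mul_one]
  have hΩST : (S⁻¹)ᵀ * (Omega n)ᵀ = (Omega n)ᵀ * S := by
    simpa only [Matrix.transpose_mul, Matrix.transpose_transpose] using congrArg Matrix.transpose hΩS
  have hST : (S⁻¹)ᵀ * Sᵀ = 1 := by
    rw [← Matrix.transpose_mul, hS1, Matrix.transpose_one]
  set C := Matrix.diagonal (fun j => (ν j)⁻¹) ⊗ₖ (1 : Matrix (Fin 2) (Fin 2) ℝ) with hC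
  have hDC : D * C = 1 := by
    have h : (fun j => ν j * (ν j)⁻¹) = fun _ => (1 : ℝ) :=
      funext fun j => mul_inv_cancel₀ (by linarith [hν j])
    rw [hD, hC, ← Matrix.mul_kronecker_mul, Matrix.diagonal_mul_diagonal, h]
    simp
  have hVinv : V⁻¹ = S⁻¹ * C * (S⁻¹)ᵀ := by
    rw [hV, Matrix.mul_inv_rev, Matrix.mul_inv_rev, Matrix.inv_eq_right_inv hDC,
      Matrix.transpose_nonsing_inv, Matrix.mul_assoc]
  have hleft : Omega n * V⁻¹ * (Omega n)ᵀ = Sᵀ * C * S := by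
    calc Omega n * V⁻¹ * (Omega n)ᵀ
        = (Omega n * S⁻¹) * C * ((S⁻¹)ᵀ * (Omega n)ᵀ) := by
          rw [hVinv]
          simp only [Matrix.mul_assoc]
      _ = Sᵀ * (Omega n * C) * (Omega n)ᵀ * S := by
          rw [hΩS, hΩST]
          simp only [Matrix.mul_assoc]
      _ = Sᵀ * C * (Omega n * (Omega n)ᵀ) * S := by
          rw [hC, Omega_commute_diagonal_kronecker]
          simp only [Matrix.mul_assoc]
      _ = Sᵀ * C * S := by rw [hΩ, Matrix.mul_one]
  have hRV : R * V = Sᵀ * (E * D) * S := by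
    calc R * V = Sᵀ * E * ((S⁻¹)ᵀ * Sᵀ) * D * S := by
          rw [hR, hV]
          simp only [Matrix.mul_assoc]
      _ = Sᵀ * (E * D) * S := by
          rw [hST, Matrix.mul_one]
          simp only [Matrix.mul_assoc]
  have hdiag : C - (D - E * D) = Matrix.diagonal
      (fun j => (ν j)⁻¹ - (1 - Real.sqrt (1 - ((ν j) ^ 2)⁻¹)) * ν j) ⊗ₖ
        (1 : Matrix (Fin 2) (Fin 2) ℝ) := by
    rw [hC, hE, hD, ← Matrix.mul_kronecker_mul, Matrix.diagonal_mul_diagonal, Matrix.one_mul]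
    ext ⟨i, a⟩ ⟨j, b⟩
    simp only [Matrix.sub_apply, Matrix.kroneckerMap_apply, Matrix.diagonal_apply]
    split_ifs <;> ring
  have hmain : Omega n * V⁻¹ * (Omega n)ᵀ - (1 - R) * V = Sᵀ * (C - (D - E * D)) * S := by
    rw [hleft, Matrix.sub_mul, Matrix.one_mul, hRV, hV]
    simp only [Matrix.mul_sub, Matrix.sub_mul]
  rw [hmain, hdiag, ← Matrix.conjTranspose_eq_transpose_of_trivial]
  exact (diagonal_kronecker_one_posDef fun j =>
    inv_sub_one_sub_sqrt_mul_pos (hν j)).conjTranspose_mul_mul_same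
      (Matrix.mulVec_injective_iff_isUnit.2 ((Matrix.isUnit_iff_isUnit_det S).2 hSdet))

end
end

section
/- Let n ≥ 1, let Ω = I_n ⊗ [[0,1],[-1,0]], let S be a real symplectic 2n×2n matrix, let ν₁,…,ν_n be reals with each ν_j > 1, let D := diag(ν₁,…,ν_n) ⊗ I₂, E := diag(√(1-ν₁⁻²),…,√(1-ν_n⁻²)) ⊗ I₂, V := SᵀDS and R := Sᵀ E S⁻ᵀ. Let V₀ be a real symmetric 2n×2n matrix such that the complex Hermitian matrix V₀ + iΩ is positive definite and V − V₀ is positive definite. Define J := R V (V − V₀)⁻¹. Then the real symmetric matrix (I − J)(V − V₀) = V − V₀ − RV is negative definite; in particular, I − J is invertible. -/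
open Matrix
open scoped Kronecker ComplexOrder

noncomputable section

/-- Complexification of a real `2n × 2n` matrix. -/
def cmat {n : ℕ} (M : Matrix (Fin n × Fin 2) (Fin n × Fin 2) ℝ) :
    Matrix (Fin n × Fin 2) (Fin n × Fin 2) ℂ :=
  M.map Complex.ofReal

theorem Omega_transpose (n : ℕ) : (Omega n)ᵀ = -Omega n := by
  ext ⟨i, a⟩ ⟨j, b⟩
  fin_cases a <;> fin_cases b <;> simp [Omega, Matrix.one_apply, eq_comm]

theorem Omega_mul_self (n : ℕ) : Omega n * Omega n = -1 := by
  have h : (!![(0 : ℝ), 1; -1, 0] * !![(0 : ℝ), 1; -1, 0]) = -1 := by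
    ext a b
    fin_cases a <;> fin_cases b <;> simp
  rw [Omega, ← Matrix.mul_kronecker_mul, h, one_mul]
  ext ⟨i, a⟩ ⟨j, b⟩
  simp only [kroneckerMap_apply, Matrix.neg_apply, Matrix.one_apply, Prod.mk.injEq]
  by_cases h1 : i = j <;> by_cases h2 : a = b <;> simp [h1, h2]

/-- The complex condition `W + iΩ > 0`, evaluated on real and imaginary parts. -/
theorem two_mul_dotProduct_Omega_lt {n : ℕ}
    {W : Matrix (Fin n × Fin 2) (Fin n × Fin 2) ℝ}
    (hW : (cmat W + Complex.I • cmat (Omega n)).PosDef)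
    {x : Fin n × Fin 2 → ℝ} (hx : x ≠ 0) (u : Fin n × Fin 2 → ℝ) :
    2 * (x ⬝ᵥ Omega n *ᵥ u) < x ⬝ᵥ W *ᵥ x + u ⬝ᵥ W *ᵥ u := by
  let z : Fin n × Fin 2 → ℂ := fun i => ⟨x i, u i⟩
  have hz : z ≠ 0 := fun h => hx <| funext fun i => congrArg Complex.re (congrFun h i)
  have hpos := (Complex.lt_def.1 (hW.dotProduct_mulVec_pos hz)).1
  have hre : (star z ⬝ᵥ (cmat W + Complex.I • cmat (Omega n)) *ᵥ z).re =
      x ⬝ᵥ W *ᵥ x + u ⬝ᵥ W *ᵥ u - x ⬝ᵥ Omega n *ᵥ u + u ⬝ᵥ Omega n *ᵥ x := by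
    simp only [dotProduct, mulVec, Finset.mul_sum, Complex.re_sum]
    simp only [← Finset.sum_add_distrib, ← Finset.sum_sub_distrib]
    refine Finset.sum_congr rfl fun i _ => Finset.sum_congr rfl fun j _ => ?_
    simp [z, cmat]
    ring
  have hanti : u ⬝ᵥ Omega n *ᵥ x = -(x ⬝ᵥ Omega n *ᵥ u) := by
    rw [dotProduct_mulVec, ← mulVec_transpose, Omega_transpose, neg_mulVec, neg_dotProduct,
      dotProduct_comm]
  rw [hre, hanti, Complex.zero_re] at hpos
  linarith

theorem inv_add_sqrt_mul_sub_nonneg {t : ℝ} (ht : 1 < t) :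
    0 ≤ t⁻¹ + (√(1 - (t ^ 2)⁻¹) * t - t) := by
  have h0 : 0 < t := by linarith
  have h1 : (t ^ 2)⁻¹ ≤ 1 := inv_le_one_of_one_le₀ (by nlinarith)
  have h2 : 1 - (t ^ 2)⁻¹ ≤ √(1 - (t ^ 2)⁻¹) :=
    Real.le_sqrt_of_sq_le (by nlinarith [inv_pos.2 (pow_pos h0 2)])
  have h3 : (1 - (t ^ 2)⁻¹) * t = t - t⁻¹ := by field_simp
  nlinarith [mul_le_mul_of_nonneg_right h2 h0.le]

/-- With `V = SᵀDS` in Williamson form, `R = √(I + (VΩ)⁻²)`, and `V₀` a real symmetric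
matrix with `V₀ + iΩ` positive definite and `V − V₀` positive definite, setting
`J := R V (V − V₀)⁻¹`, the matrix `(I − J)(V − V₀) = V − V₀ − RV` is negative
definite; in particular `I − J` is invertible. -/
theorem iMinusJ_neg_def (n : ℕ) (hn : 1 ≤ n)
    (S : Matrix (Fin n × Fin 2) (Fin n × Fin 2) ℝ)
    (hS : Sᵀ * Omega n * S = Omega n)
    (ν : Fin n → ℝ) (hν : ∀ j, 1 < ν j)
    (D E V R : Matrix (Fin n × Fin 2) (Fin n × Fin 2) ℝ)
    (hD : D = (Matrix.diagonal ν) ⊗ₖ (1 : Matrix (Fin 2) (Fin 2) ℝ))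
    (hE : E = (Matrix.diagonal fun j => Real.sqrt (1 - ((ν j) ^ 2)⁻¹)) ⊗ₖ
      (1 : Matrix (Fin 2) (Fin 2) ℝ))
    (hV : V = Sᵀ * D * S)
    (hR : R = Sᵀ * E * (S⁻¹)ᵀ)
    (V₀ : Matrix (Fin n × Fin 2) (Fin n × Fin 2) ℝ) (hV₀symm : V₀.IsSymm)
    (hV₀ : (cmat V₀ + Complex.I • cmat (Omega n)).PosDef)
    (hVV₀ : (V - V₀).PosDef)
    (J : Matrix (Fin n × Fin 2) (Fin n × Fin 2) ℝ)
    (hJ : J = R * V * (V - V₀)⁻¹) :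
    (1 - J) * (V - V₀) = V - V₀ - R * V ∧
    (-(V - V₀ - R * V)).PosDef ∧ IsUnit (1 - J) := by
  let a : Fin n × Fin 2 → ℝ := fun p => ν p.1
  let e : Fin n × Fin 2 → ℝ := fun p => √(1 - (ν p.1 ^ 2)⁻¹)
  have hD' : D = diagonal a := by
    rw [hD, ← diagonal_one, diagonal_kronecker_diagonal]
    simp [a]
  have hE' : E = diagonal e := by
    rw [hE, ← diagonal_one, diagonal_kronecker_diagonal]
    simp [e]
  have ha : ∀ p, 0 < a p := fun p => one_pos.trans (hν p.1)
  have hSu : IsUnit S.det := by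
    refine (Matrix.isUnit_iff_isUnit_det S).1
      (IsUnit.of_mul_eq_one_right (-(Omega n * Sᵀ * Omega n)) ?_)
    rw [neg_mul, mul_assoc, mul_assoc, ← mul_assoc Sᵀ, hS, Omega_mul_self, neg_neg]
  have hRV : R * V = Sᵀ * (E * D) * S := by
    have h : (S⁻¹)ᵀ * Sᵀ = 1 := by
      rw [← transpose_mul, mul_nonsing_inv _ hSu, transpose_one]
    calc R * V = Sᵀ * E * ((S⁻¹)ᵀ * Sᵀ) * D * S := by rw [hR, hV]; simp only [mul_assoc]
      _ = Sᵀ * (E * D) * S := by rw [h, mul_one, mul_assoc Sᵀ]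
  have hVu : IsUnit (V - V₀).det := (Matrix.isUnit_iff_isUnit_det _).1 hVV₀.isUnit
  have hmul : (1 - J) * (V - V₀) = V - V₀ - R * V := by
    rw [sub_mul, one_mul, hJ, mul_assoc, nonsing_inv_mul _ hVu, mul_one]
  have hdiff : -(V - V₀ - R * V) = V₀ + Sᵀ * (E * D - D) * S := by
    rw [hRV, hV, mul_sub, sub_mul]
    abel
  have hpd : (-(V - V₀ - R * V)).PosDef := by
    rw [hdiff]
    refine PosDef.of_dotProduct_mulVec_pos ?_ fun x hx => ?_
    · change (V₀ + Sᵀ * (E * D - D) * S)ᴴ = _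
      rw [conjTranspose_eq_transpose_of_trivial, transpose_add, hV₀symm.eq, hD', hE',
        diagonal_mul_diagonal, diagonal_sub]
      simp only [transpose_mul, transpose_transpose, diagonal_transpose, mul_assoc]
    · have hquad (M : Matrix (Fin n × Fin 2) (Fin n × Fin 2) ℝ) (v : Fin n × Fin 2 → ℝ) :
          v ⬝ᵥ (Sᵀ * M * S) *ᵥ v = (S *ᵥ v) ⬝ᵥ M *ᵥ (S *ᵥ v) := by
        rw [← mulVec_mulVec, ← mulVec_mulVec, dotProduct_mulVec, vecMul_transpose]
      set y := S *ᵥ x with hy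
      let w := (Omega n)ᵀ *ᵥ (diagonal a⁻¹ *ᵥ y)
      let u := S⁻¹ *ᵥ w
      have hSw : S *ᵥ u = w := by
        rw [mulVec_mulVec, mul_nonsing_inv _ hSu, one_mulVec]
      have hDcomm : Omega n * D * (Omega n)ᵀ = D := by
        have h : Omega n * D = D * Omega n := by
          rw [hD, Omega, ← mul_kronecker_mul, ← mul_kronecker_mul, one_mul, mul_one, one_mul,
            mul_one]
        rw [h, Omega_transpose, mul_neg, mul_assoc, Omega_mul_self, mul_neg, mul_one, neg_neg]
      have hinv : D *ᵥ (diagonal a⁻¹ *ᵥ y) = y := by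
        ext p
        simp [hD', mulVec_diagonal, (ha p).ne']
      have hcross : x ⬝ᵥ Omega n *ᵥ u = y ⬝ᵥ diagonal a⁻¹ *ᵥ y := by
        conv_lhs => rw [← hS]
        rw [← mulVec_mulVec, ← mulVec_mulVec, hSw, dotProduct_mulVec, vecMul_transpose, ← hy,
          mulVec_mulVec, Omega_transpose, mul_neg, Omega_mul_self, neg_neg, one_mulVec]
      have huu : u ⬝ᵥ V *ᵥ u = y ⬝ᵥ diagonal a⁻¹ *ᵥ y := by
        rw [hV, hquad, hSw]
        have h (v : Fin n × Fin 2 → ℝ) : ((Omega n)ᵀ *ᵥ v) ⬝ᵥ D *ᵥ ((Omega n)ᵀ *ᵥ v) =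
            v ⬝ᵥ D *ᵥ v := by
          conv_rhs => rw [← hDcomm]
          rw [← mulVec_mulVec, ← mulVec_mulVec, dotProduct_mulVec v, ← mulVec_transpose]
        rw [h, hinv, dotProduct_comm]
      have hle : u ⬝ᵥ V₀ *ᵥ u ≤ u ⬝ᵥ V *ᵥ u := by
        have h := hVV₀.posSemidef.dotProduct_mulVec_nonneg u
        rw [star_trivial, sub_mulVec, dotProduct_sub] at h
        linarith
      have hlt := two_mul_dotProduct_Omega_lt hV₀ hx u
      have hdiag : 0 ≤ y ⬝ᵥ diagonal a⁻¹ *ᵥ y + y ⬝ᵥ (E * D - D) *ᵥ y := by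
        rw [hD', hE', diagonal_mul_diagonal, diagonal_sub, ← dotProduct_add, ← add_mulVec,
          diagonal_add]
        refine Finset.sum_nonneg fun p _ => ?_
        rw [mulVec_diagonal]
        have h := mul_nonneg (inv_add_sqrt_mul_sub_nonneg (hν p.1)) (mul_self_nonneg (y p))
        simp only [Pi.inv_apply, a, e]
        linarith
      rw [star_trivial, add_mulVec, dotProduct_add, hquad]
      linarith
  refine ⟨hmul, hpd, ?_⟩
  have hu : IsUnit ((1 - J) * (V - V₀)) := by
    rw [hmul, ← IsUnit.neg_iff]
    exact hpd.isUnit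
  exact (hVV₀.isUnit.mul_right_iff).1 hu

end
end

section
/- Let n ≥ 1, let Ω = I_n ⊗ [[0,1],[-1,0]], let S be a real symplectic 2n×2n matrix, let ν₁,…,ν_n be reals with each ν_j > 1, let D := diag(ν₁,…,ν_n) ⊗ I₂, E := diag(√(1-ν₁⁻²),…,√(1-ν_n⁻²)) ⊗ I₂, V := SᵀDS and R := Sᵀ E S⁻ᵀ. Let V_τ be a real symmetric 2n×2n matrix such that the complex Hermitian matrix V_τ + iΩ is positive definite and V − V_τ is positive definite. Define the real symmetric matrix V₅ := −V + R V (V − V_τ)⁻¹ V Rᵀ. Then the complex Hermitian matrix V₅ − iΩ is positive definite, and consequently V₅ is a real symmetric positive-definite matrix. -/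
open Matrix
open scoped Kronecker ComplexOrder

noncomputable section

theorem Matrix.PosDef.inv_sub_inv {ι 𝕜 : Type*} [Fintype ι] [DecidableEq ι] [RCLike 𝕜]
    {A B : Matrix ι ι 𝕜} (hA : A.PosDef) (hAB : (B - A).PosDef) : (A⁻¹ - B⁻¹).PosDef := by
  have hB : B.PosDef := by simpa using hAB.add hA
  have hAdet := (isUnit_iff_isUnit_det A).mp hA.isUnit
  have hBdet := (isUnit_iff_isUnit_det B).mp hB.isUnit
  have hpos : ((B - A) + (B - A)ᴴ * A⁻¹ * (B - A)).PosDef :=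
    hAB.add (hA.inv.conjTranspose_mul_mul_same (mulVec_injective_of_isUnit hAB.isUnit))
  have hinj : Function.Injective (B⁻¹).mulVec := mulVec_injective_of_isUnit hB.inv.isUnit
  have key := hpos.conjTranspose_mul_mul_same hinj
  rw [hB.inv.isHermitian.eq, hAB.isHermitian.eq] at key
  have hfactor : (B - A) + (B - A) * A⁻¹ * (B - A) = (B - A) * A⁻¹ * B := by
    simp only [mul_sub, sub_mul, mul_nonsing_inv A hAdet, mul_assoc,
      nonsing_inv_mul A hAdet, mul_one, one_mul]
    abel
  rw [hfactor] at key
  have h : B⁻¹ * ((B - A) * A⁻¹ * B) * B⁻¹ = A⁻¹ - B⁻¹ := by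
    rw [← mul_assoc, mul_nonsing_inv_cancel_right _ _ hBdet, sub_mul,
      mul_nonsing_inv A hAdet, mul_sub, mul_one, nonsing_inv_mul_cancel_left _ _ hBdet]
  rwa [h] at key

theorem Matrix.PosDef.inv_conj_sub_posDef {ι 𝕜 : Type*} [Fintype ι] [DecidableEq ι] [RCLike 𝕜]
    {A B K X J : Matrix ι ι 𝕜} (hA : A.PosDef) (hAB : (B - A).PosDef) (hK : IsUnit K)
    (hBX : B * X = K) (hKX : Kᴴ * X = J) : (Kᴴ * A⁻¹ * K - J).PosDef := by
  have hB : B.PosDef := by simpa using hAB.add hA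
  have hBdet := (isUnit_iff_isUnit_det B).mp hB.isUnit
  have key := (hA.inv_sub_inv hAB).conjTranspose_mul_mul_same (mulVec_injective_of_isUnit hK)
  have hX : B⁻¹ * K = X := by rw [← hBX, nonsing_inv_mul_cancel_left _ _ hBdet]
  rwa [mul_sub, sub_mul, mul_assoc _ B⁻¹, hX, hKX] at key

open scoped MatrixOrder in
theorem Matrix.PosDef.map_ofReal {ι : Type*} [Fintype ι] [DecidableEq ι]
    {A : Matrix ι ι ℝ} (hA : A.PosDef) : (A.map Complex.ofReal).PosDef := by
  obtain ⟨B, hB⟩ := CStarAlgebra.nonneg_iff_eq_star_mul_self.mp hA.posSemidef.nonneg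
  have hBunit : IsUnit B := by
    have h := (isUnit_iff_isUnit_det A).mp hA.isUnit
    rw [hB, det_mul] at h
    exact (isUnit_iff_isUnit_det B).mpr (isUnit_of_mul_isUnit_right h)
  have hmap : A.map Complex.ofReal = (B.map Complex.ofReal)ᴴ * B.map Complex.ofReal := by
    rw [hB]
    ext i j
    simp [mul_apply, star_eq_conjTranspose]
  rw [hmap]
  exact .conjTranspose_mul_self _
    (mulVec_injective_of_isUnit (hBunit.map Complex.ofRealHom.mapMatrix))

theorem Matrix.PosDef.of_map_ofReal {ι : Type*} [Fintype ι]
    {A : Matrix ι ι ℝ} (hA : (A.map Complex.ofReal).PosDef) : A.PosDef := by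
  refine .of_dotProduct_mulVec_pos ?_ fun x hx => ?_
  · ext i j
    have h := congrFun (congrFun hA.isHermitian i) j
    simpa using h
  · have hx' : (fun i => (x i : ℂ)) ≠ 0 := fun h => hx <| funext fun i => by
      simpa using congrFun h i
    have h := hA.dotProduct_mulVec_pos hx'
    have e : star (fun i => (x i : ℂ)) ⬝ᵥ (A.map Complex.ofReal *ᵥ fun i => (x i : ℂ))
        = ((star x ⬝ᵥ (A *ᵥ x) : ℝ) : ℂ) := by
      simp [dotProduct, mulVec]
    rw [e] at h
    exact_mod_cast h

section cmat

variable {n : ℕ} (M N : Matrix (Fin n × Fin 2) (Fin n × Fin 2) ℝ)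

theorem cmat_add : cmat (M + N) = cmat M + cmat N :=
  map_add Complex.ofRealHom.mapMatrix M N

theorem cmat_sub : cmat (M - N) = cmat M - cmat N :=
  map_sub Complex.ofRealHom.mapMatrix M N

theorem cmat_neg : cmat (-M) = -cmat M :=
  map_neg Complex.ofRealHom.mapMatrix M

theorem cmat_mul : cmat (M * N) = cmat M * cmat N :=
  map_mul Complex.ofRealHom.mapMatrix M N

theorem cmat_one : cmat (1 : Matrix (Fin n × Fin 2) (Fin n × Fin 2) ℝ) = 1 :=
  map_one Complex.ofRealHom.mapMatrix

theorem cmat_conjTranspose : (cmat M)ᴴ = cmat Mᵀ := by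
  ext i j
  simp [cmat]

theorem cmat_transpose : (cmat M)ᵀ = cmat Mᵀ := rfl

variable {M} in
theorem cmat_inv (hM : IsUnit M) : cmat M⁻¹ = (cmat M)⁻¹ := by
  refine (inv_eq_left_inv ?_).symm
  rw [← cmat_mul, nonsing_inv_mul _ ((isUnit_iff_isUnit_det M).mp hM), cmat_one]

end cmat

theorem isUnit_of_symplectic {n : ℕ} {S : Matrix (Fin n × Fin 2) (Fin n × Fin 2) ℝ}
    (hS : Sᵀ * Omega n * S = Omega n) : IsUnit S := by
  refine IsUnit.of_mul_eq_one_right (-Omega n * (Sᵀ * Omega n)) ?_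
  rw [mul_assoc, hS, neg_mul, Omega_mul_self, neg_neg]

theorem diagonal_kronecker_one_commute_Omega {n : ℕ} (d : Fin n → ℝ) :
    Commute (diagonal d ⊗ₖ (1 : Matrix (Fin 2) (Fin 2) ℝ)) (Omega n) := by
  simp [Commute, SemiconjBy, Omega, ← mul_kronecker_mul]

/-- With `V = SᵀDS` and `K = SᵀFS`, some `X` satisfies `(V - iΩ) X = K` and `K X = V + iΩ`. -/
theorem exists_mul_eq_and_mul_eq {n : ℕ} {S : Matrix (Fin n × Fin 2) (Fin n × Fin 2) ℝ}
    (hS : Sᵀ * Omega n * S = Omega n) {D F G : Matrix (Fin n × Fin 2) (Fin n × Fin 2) ℝ}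
    (hD : Commute D (Omega n)) (hGD : Commute G D) (hG : Commute G (Omega n))
    (hFG : F * G = 1) (hFF : F * F = D * D - 1) :
    ∃ X, (cmat (Sᵀ * D * S) - Complex.I • cmat (Omega n)) * X = cmat (Sᵀ * F * S) ∧
      cmat (Sᵀ * F * S) * X = cmat (Sᵀ * D * S) + Complex.I • cmat (Omega n) := by
  have hSdet := (isUnit_iff_isUnit_det S).mp (isUnit_of_symplectic hS)
  have hSS : cmat S * cmat S⁻¹ = 1 := by rw [← cmat_mul, mul_nonsing_inv _ hSdet, cmat_one]
  have hGF : G * F = 1 := mul_eq_one_comm.mp hFG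
  have hΩ := congrArg cmat hS
  have hΩΩ := congrArg cmat (Omega_mul_self n)
  have hD' := congrArg cmat hD.eq
  have hGD' := congrArg cmat hGD.eq
  have hG' := congrArg cmat hG.eq
  have hFG' := congrArg cmat hFG
  have hGF' := congrArg cmat hGF
  have hFF' := congrArg cmat hFF
  simp only [cmat_mul, cmat_neg, cmat_sub, cmat_one] at hΩ hΩΩ hD' hGD' hG' hFG' hGF' hFF'
  simp only [cmat_mul]
  rw [← hΩ]
  generalize cmat S = s at *
  generalize cmat S⁻¹ = s' at *
  generalize cmat Sᵀ = t at *
  generalize cmat D = d at *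
  generalize cmat F = f at *
  generalize cmat G = g at *
  generalize cmat (Omega n) = w at *
  have hprod : (d - Complex.I • w) * (d + Complex.I • w) = f * f := by
    rw [sub_mul, mul_add, mul_add, smul_mul_assoc, smul_mul_assoc, mul_smul_comm, mul_smul_comm,
      smul_smul, Complex.I_mul_I, hΩΩ, hD', hFF', neg_one_smul, neg_neg]
    abel
  have hcomm : (d - Complex.I • w) * g = g * (d - Complex.I • w) := by
    rw [sub_mul, mul_sub, smul_mul_assoc, mul_smul_comm, hGD', hG']
  have e1 : t * d * s - Complex.I • (t * w * s) = t * (d - Complex.I • w) * s := by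
    simp [mul_sub, sub_mul]
  have e2 : t * d * s + Complex.I • (t * w * s) = t * (d + Complex.I • w) * s := by
    simp [mul_add, add_mul]
  rw [e1, e2]
  refine ⟨s' * g * (d + Complex.I • w) * s, ?_, ?_⟩
  · calc t * (d - Complex.I • w) * s * (s' * g * (d + Complex.I • w) * s)
        = t * (d - Complex.I • w) * (s * s') * g * (d + Complex.I • w) * s := by noncomm_ring
      _ = t * ((d - Complex.I • w) * g) * (d + Complex.I • w) * s := by
        rw [hSS, mul_one]; simp only [mul_assoc]
      _ = t * g * ((d - Complex.I • w) * (d + Complex.I • w)) * s := by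
        rw [hcomm]; simp only [mul_assoc]
      _ = t * (g * f) * f * s := by rw [hprod]; simp only [mul_assoc]
      _ = t * f * s := by rw [hGF', mul_one]
  · calc t * f * s * (s' * g * (d + Complex.I • w) * s)
        = t * f * (s * s') * g * (d + Complex.I • w) * s := by simp only [mul_assoc]
      _ = t * (f * g) * (d + Complex.I • w) * s := by
        rw [hSS, mul_one]; simp only [mul_assoc]
      _ = t * (d + Complex.I • w) * s := by rw [hFG', mul_one]

/-- With `V = SᵀDS` in Williamson form, `R = √(I + (VΩ)⁻²)`, and `V_τ` real symmetric
with `V_τ + iΩ` and `V − V_τ` positive definite, the matrix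
`V₅ := −V + R V (V − V_τ)⁻¹ V Rᵀ` satisfies `V₅ − iΩ > 0`, and consequently `V₅`
is (real symmetric) positive definite. -/
theorem V5_sub_iOmega_posDef (n : ℕ) (hn : 1 ≤ n)
    (S : Matrix (Fin n × Fin 2) (Fin n × Fin 2) ℝ)
    (hS : Sᵀ * Omega n * S = Omega n)
    (ν : Fin n → ℝ) (hν : ∀ j, 1 < ν j)
    (D E V R : Matrix (Fin n × Fin 2) (Fin n × Fin 2) ℝ)
    (hD : D = (Matrix.diagonal ν) ⊗ₖ (1 : Matrix (Fin 2) (Fin 2) ℝ))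
    (hE : E = (Matrix.diagonal fun j => Real.sqrt (1 - ((ν j) ^ 2)⁻¹)) ⊗ₖ
      (1 : Matrix (Fin 2) (Fin 2) ℝ))
    (hV : V = Sᵀ * D * S)
    (hR : R = Sᵀ * E * (S⁻¹)ᵀ)
    (Vτ : Matrix (Fin n × Fin 2) (Fin n × Fin 2) ℝ) (hVτsymm : Vτ.IsSymm)
    (hVτ : (cmat Vτ + Complex.I • cmat (Omega n)).PosDef)
    (hVVτ : (V - Vτ).PosDef)
    (V₅ : Matrix (Fin n × Fin 2) (Fin n × Fin 2) ℝ)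
    (hV₅ : V₅ = -V + R * V * (V - Vτ)⁻¹ * V * Rᵀ) :
    (cmat V₅ - Complex.I • cmat (Omega n)).PosDef ∧ V₅.PosDef := by
  have hSunit := isUnit_of_symplectic hS
  have hSdet := (isUnit_iff_isUnit_det S).mp hSunit
  set e : Fin n → ℝ := fun j => Real.sqrt (1 - ((ν j) ^ 2)⁻¹)
  have hνpos : ∀ j, 0 < ν j := fun j => one_pos.trans (hν j)
  have hrad : ∀ j, 0 < 1 - ((ν j) ^ 2)⁻¹ := fun j =>
    sub_pos.mpr (inv_lt_one_of_one_lt₀ (one_lt_pow₀ (hν j) two_ne_zero))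
  have hepos : ∀ j, 0 < e j := fun j => Real.sqrt_pos.mpr (hrad j)
  set f : Fin n → ℝ := fun j => ν j * e j with hf
  have hfpos : ∀ j, 0 < f j := fun j => mul_pos (hνpos j) (hepos j)
  have hfsq : ∀ j, f j * f j = ν j * ν j - 1 := fun j => by
    have h1 : e j * e j = 1 - ((ν j) ^ 2)⁻¹ := Real.mul_self_sqrt (hrad j).le
    have h2 := (hνpos j).ne'
    calc f j * f j = ν j ^ 2 * (e j * e j) := by simp only [hf]; ring
      _ = ν j * ν j - 1 := by rw [h1]; field_simp
  set F : Matrix (Fin n × Fin 2) (Fin n × Fin 2) ℝ := diagonal f ⊗ₖ 1 with hF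
  set G : Matrix (Fin n × Fin 2) (Fin n × Fin 2) ℝ := diagonal (fun j => (f j)⁻¹) ⊗ₖ 1 with hG
  have hED : E * D = F := by
    rw [hD, hE, hF, ← mul_kronecker_mul, diagonal_mul_diagonal, one_mul]
    simp only [hf, mul_comm]
  have hFG : F * G = 1 := by
    rw [hF, hG, ← mul_kronecker_mul, diagonal_mul_diagonal, one_mul]
    simp [(hfpos _).ne']
  have hFF : F * F = D * D - 1 := by
    rw [eq_sub_iff_add_eq, hF, hD, ← mul_kronecker_mul, ← mul_kronecker_mul,
      diagonal_mul_diagonal, diagonal_mul_diagonal, one_mul, ← one_kronecker_one, ← add_kronecker,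
      ← diagonal_one, diagonal_add]
    simp only [hfsq, sub_add_cancel]
  have hGD : Commute G D := by
    simp only [Commute, SemiconjBy, hG, hD, ← mul_kronecker_mul, diagonal_mul_diagonal, mul_comm]
  have hDt : Dᵀ = D := by simp [hD, ← kroneckerMap_transpose]
  have hVt : Vᵀ = V := by simp [hV, hDt, mul_assoc]
  have hRV : R * V = Sᵀ * F * S := by
    have h : (S⁻¹)ᵀ * Sᵀ = 1 := by
      rw [← transpose_mul, mul_nonsing_inv _ hSdet, transpose_one]
    calc R * V = Sᵀ * E * ((S⁻¹)ᵀ * Sᵀ) * D * S := by rw [hR, hV]; simp only [mul_assoc]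
      _ = Sᵀ * (E * D) * S := by rw [h, mul_one]; simp only [mul_assoc]
      _ = Sᵀ * F * S := by rw [hED]
  have hFt : Fᵀ = F := by simp [hF, ← kroneckerMap_transpose]
  have hKt : (Sᵀ * F * S)ᵀ = Sᵀ * F * S := by simp [hFt, mul_assoc]
  have hVR : V * Rᵀ = Sᵀ * F * S := by
    rw [← hKt, ← hRV, transpose_mul, hVt]
  set K := Sᵀ * F * S with hK
  have hKunit : IsUnit K :=
    ((isUnit_transpose S).mpr hSunit |>.mul (IsUnit.of_mul_eq_one _ hFG)).mul hSunit
  have hV₅K : V₅ = -V + K * (V - Vτ)⁻¹ * K := by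
    rw [hV₅, hRV, mul_assoc _ V, hVR]
  obtain ⟨X, hX1, hX2⟩ := exists_mul_eq_and_mul_eq hS
    (hD ▸ diagonal_kronecker_one_commute_Omega ν) hGD
    (diagonal_kronecker_one_commute_Omega _) hFG hFF
  rw [← hV, ← hK] at hX1 hX2
  have hKH : (cmat K)ᴴ = cmat K := by rw [cmat_conjTranspose, hKt]
  have hVτ' : (cmat Vτ - Complex.I • cmat (Omega n)).PosDef := by
    have h := hVτ.transpose
    rwa [transpose_add, transpose_smul, cmat_transpose, cmat_transpose, hVτsymm.eq,
      Omega_transpose, cmat_neg, smul_neg, ← sub_eq_add_neg] at h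
  have hmain : (cmat V₅ - Complex.I • cmat (Omega n)).PosDef := by
    have h := hVVτ.map_ofReal.inv_conj_sub_posDef
      (B := cmat V - Complex.I • cmat (Omega n)) (K := cmat K) (X := X)
      (J := cmat V + Complex.I • cmat (Omega n)) ?_ (hKunit.map Complex.ofRealHom.mapMatrix) hX1
      (by rw [hKH, hX2])
    · change ((cmat K)ᴴ * (cmat (V - Vτ))⁻¹ * cmat K - _).PosDef at h
      rw [hKH, ← cmat_inv hVVτ.isUnit, ← cmat_mul, ← cmat_mul] at h
      convert h using 1
      rw [hV₅K, cmat_add, cmat_neg]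
      abel
    · change (_ - cmat (V - Vτ)).PosDef
      convert hVτ' using 1
      rw [cmat_sub]
      abel
  refine ⟨hmain, .of_map_ofReal ?_⟩
  have hAt : (V - Vτ)ᵀ = V - Vτ := by rw [transpose_sub, hVt, hVτsymm.eq]
  have hV₅t : V₅ᵀ = V₅ := by
    rw [hV₅K, transpose_add, transpose_neg, hVt, transpose_mul _ K, transpose_mul K, hKt,
      transpose_nonsing_inv, hAt, ← mul_assoc]
  have h := hmain.transpose
  rw [transpose_sub, transpose_smul, cmat_transpose, cmat_transpose, hV₅t, Omega_transpose,
    cmat_neg, smul_neg, sub_neg_eq_add] at h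
  have hsum := (hmain.add h).smul (show (0 : ℝ) < 1 / 2 by norm_num)
  change (cmat V₅).PosDef
  convert hsum using 1
  rw [sub_add_add_cancel, ← two_smul ℝ (cmat V₅), smul_smul]
  norm_num

end
end

section
/- Let n ≥ 1, let Ω = I_n ⊗ [[0,1],[-1,0]], let S be a real symplectic 2n×2n matrix, let ν₁,…,ν_n be reals with each ν_j > 1, let D := diag(ν₁,…,ν_n) ⊗ I₂, E := diag(√(1-ν₁⁻²),…,√(1-ν_n⁻²)) ⊗ I₂, V := SᵀDS and R := Sᵀ E S⁻ᵀ. Let V₀ be a real symmetric 2n×2n matrix, L an invertible real 2n×2n matrix, and Σ a real symmetric positive-definite 2n×2n matrix with V − V₀ = 2 L Σ Lᵀ. Define J := R V (V − V₀)⁻¹. Then det J = det((V + iΩ)/2) / ((det L)² · det Σ), where det((V + iΩ)/2) denotes the (real, positive) determinant of the complex matrix (V + iΩ)/2. -/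
open Matrix
open scoped Kronecker

noncomputable section

theorem det_omega (n : ℕ) : (Omega n).det = 1 := by
  simp [Omega, Matrix.det_kronecker, Matrix.det_fin_two]

/-- A `2n × 2n` matrix with `2 × 2` blocks `ν j • I₂ + i • [[0,1],[-1,0]]` on the diagonal has
determinant `∏ j, (ν j ^ 2 - 1)`. -/
theorem det_cmat_diagonal_add_I_smul_omega {n : ℕ} (ν : Fin n → ℝ) :
    (cmat ((Matrix.diagonal ν) ⊗ₖ (1 : Matrix (Fin 2) (Fin 2) ℝ)) +
      Complex.I • cmat (Omega n)).det = ∏ j, ((ν j : ℂ) ^ 2 - 1) := by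
  have h : cmat ((Matrix.diagonal ν) ⊗ₖ (1 : Matrix (Fin 2) (Fin 2) ℝ)) +
      Complex.I • cmat (Omega n) =
      (Matrix.blockDiagonal fun j : Fin n =>
        !![(ν j : ℂ), Complex.I; -Complex.I, (ν j : ℂ)]).submatrix
        (Equiv.prodComm (Fin n) (Fin 2)) (Equiv.prodComm (Fin n) (Fin 2)) := by
    ext ⟨i, a⟩ ⟨j, b⟩
    by_cases hij : i = j
    · subst hij
      fin_cases a <;> fin_cases b <;> simp [cmat, Omega, Matrix.blockDiagonal_apply]
    · simp [cmat, Omega, Matrix.blockDiagonal_apply, hij]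
  rw [h, Matrix.det_submatrix_equiv_self, Matrix.det_blockDiagonal]
  refine Finset.prod_congr rfl fun j _ => ?_
  rw [Matrix.det_fin_two_of]
  linear_combination Complex.I_sq

theorem cmat_mul_s11 {n : ℕ} (A B : Matrix (Fin n × Fin 2) (Fin n × Fin 2) ℝ) :
    cmat (A * B) = cmat A * cmat B :=
  Matrix.map_mul (f := Complex.ofRealHom)

theorem det_cmat {n : ℕ} (A : Matrix (Fin n × Fin 2) (Fin n × Fin 2) ℝ) :
    (cmat A).det = (A.det : ℂ) :=
  (RingHom.map_det Complex.ofRealHom A).symm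

/-- With `V = SᵀDS` in Williamson form, `R = √(I + (VΩ)⁻²)`, and
`V − V₀ = 2·L·Sig·Lᵀ` with `L` invertible and `Sig` symmetric positive definite,
for `J := R V (V − V₀)⁻¹` one has `det J = det((V + iΩ)/2) / ((det L)² det Sig)`. -/
theorem det_J_eq (n : ℕ) (hn : 1 ≤ n)
    (S : Matrix (Fin n × Fin 2) (Fin n × Fin 2) ℝ)
    (hS : Sᵀ * Omega n * S = Omega n)
    (ν : Fin n → ℝ) (hν : ∀ j, 1 < ν j)
    (D E V R : Matrix (Fin n × Fin 2) (Fin n × Fin 2) ℝ)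
    (hD : D = (Matrix.diagonal ν) ⊗ₖ (1 : Matrix (Fin 2) (Fin 2) ℝ))
    (hE : E = (Matrix.diagonal fun j => Real.sqrt (1 - ((ν j) ^ 2)⁻¹)) ⊗ₖ
      (1 : Matrix (Fin 2) (Fin 2) ℝ))
    (hV : V = Sᵀ * D * S)
    (hR : R = Sᵀ * E * (S⁻¹)ᵀ)
    (V₀ L Sig : Matrix (Fin n × Fin 2) (Fin n × Fin 2) ℝ)
    (hV₀symm : V₀.IsSymm) (hL : IsUnit L)
    (hSigSymm : Sig.IsSymm) (hSig : Sig.PosDef)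
    (hLSig : V - V₀ = (2 : ℝ) • (L * Sig * Lᵀ))
    (J : Matrix (Fin n × Fin 2) (Fin n × Fin 2) ℝ)
    (hJ : J = R * V * (V - V₀)⁻¹) :
    (J.det : ℂ) =
      ((2 : ℂ)⁻¹ • (cmat V + Complex.I • cmat (Omega n))).det /
        (((L.det : ℂ)) ^ 2 * (Sig.det : ℂ)) := by
  have hSdet : S.det ^ 2 = 1 := by
    have h := congrArg Matrix.det hS
    simp only [Matrix.det_mul, Matrix.det_transpose, det_omega] at h
    linear_combination h
  have hS0 : S.det ≠ 0 := fun h => by simp [h] at hSdet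
  have hdetR : R.det = E.det := by
    rw [hR, Matrix.det_mul, Matrix.det_mul, Matrix.det_transpose, Matrix.det_transpose,
      Matrix.det_nonsing_inv, Ring.inverse_eq_inv']
    field_simp
  have hdetV : V.det = D.det := by
    rw [hV, Matrix.det_mul, Matrix.det_mul, Matrix.det_transpose]
    linear_combination D.det * hSdet
  have hdetED : E.det * D.det = ∏ j, ((ν j) ^ 2 - 1) := by
    rw [hE, hD]
    simp only [Matrix.det_kronecker, Matrix.det_diagonal, Matrix.det_one, one_pow, mul_one,
      Fintype.card_fin, ← Finset.prod_pow, ← Finset.prod_mul_distrib]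
    refine Finset.prod_congr rfl fun j _ => ?_
    have hj := hν j
    have h0 : ν j ≠ 0 := by positivity
    rw [Real.sq_sqrt (sub_nonneg.2 (inv_le_one_of_one_le₀ (one_le_pow₀ hj.le)))]
    field_simp
  have hdetJ : J.det = (∏ j, ((ν j) ^ 2 - 1)) *
      ((2 : ℝ) ^ Fintype.card (Fin n × Fin 2) * (L.det ^ 2 * Sig.det))⁻¹ := by
    rw [hJ, Matrix.det_mul, Matrix.det_mul, Matrix.det_nonsing_inv, Ring.inverse_eq_inv', hLSig,
      Matrix.det_smul, Matrix.det_mul, Matrix.det_mul, Matrix.det_transpose, hdetR, hdetV, hdetED]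
    ring_nf
  have hVΩ : cmat V + Complex.I • cmat (Omega n) =
      cmat Sᵀ * (cmat D + Complex.I • cmat (Omega n)) * cmat S := by
    rw [mul_add, add_mul, Matrix.mul_smul, Matrix.smul_mul, ← cmat_mul_s11, ← cmat_mul_s11, ← cmat_mul_s11,
      ← cmat_mul_s11, hS, ← hV]
  have hSdetC : (S.det : ℂ) ^ 2 = 1 := by exact_mod_cast hSdet
  have hdetVΩ : (cmat V + Complex.I • cmat (Omega n)).det = ∏ j, ((ν j : ℂ) ^ 2 - 1) := by
    rw [hVΩ, Matrix.det_mul, Matrix.det_mul, det_cmat, det_cmat, Matrix.det_transpose, hD,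
      det_cmat_diagonal_add_I_smul_omega]
    linear_combination (∏ j, ((ν j : ℂ) ^ 2 - 1)) * hSdetC
  rw [Matrix.det_smul, hdetVΩ, hdetJ]
  push_cast
  rw [inv_pow, mul_inv, div_eq_mul_inv]
  ring

end
end

section
/- Let V and V₀ be real symmetric 2n×2n matrices with V invertible, let R be an invertible real 2n×2n matrix, let L be an invertible real 2n×2n matrix, and let Σ be an invertible real symmetric 2n×2n matrix such that V − V₀ = 2 L Σ Lᵀ is invertible. Define J := R V (V − V₀)⁻¹, V_σ := −V + (1/2) R V L⁻ᵀ Σ⁻¹ L⁻¹ V Rᵀ, and A := L⁻¹ J⁻¹ L. Then (1/2) L⁻¹ J⁻¹ (V_σ + V₀) J⁻ᵀ L⁻ᵀ = Σ − A Σ Aᵀ. -/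
open Matrix

namespace Matrix

variable {m : Type*} [Fintype m] [DecidableEq m]

theorem inv_mul_conj_sub_mul_inv_transpose {J : Matrix m m ℝ} (hJ : IsUnit J) (W : Matrix m m ℝ) :
    J⁻¹ * (J * W * Jᵀ - W) * (J⁻¹)ᵀ = W - J⁻¹ * W * (J⁻¹)ᵀ := by
  have hinv : J⁻¹ * J = 1 := nonsing_inv_mul J ((isUnit_iff_isUnit_det J).mp hJ)
  have htranspose : Jᵀ * (J⁻¹)ᵀ = 1 := by rw [← transpose_mul, hinv, transpose_one]
  rw [Matrix.mul_sub, Matrix.sub_mul]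
  congr 1
  calc J⁻¹ * (J * W * Jᵀ) * (J⁻¹)ᵀ = (J⁻¹ * J) * W * (Jᵀ * (J⁻¹)ᵀ) := by
        simp only [Matrix.mul_assoc]
    _ = W := by rw [hinv, htranspose, Matrix.one_mul, Matrix.mul_one]

theorem inv_two_smul_conj_transpose (L S : Matrix m m ℝ) :
    ((2 : ℝ) • (L * S * Lᵀ))⁻¹ = (2 : ℝ)⁻¹ • ((L⁻¹)ᵀ * S⁻¹ * L⁻¹) := by
  have hsmul : (2 : ℝ) • (L * S * Lᵀ) = ((2 : ℝ) • (1 : Matrix m m ℝ)) * (L * S * Lᵀ) := by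
    rw [Matrix.smul_mul, Matrix.one_mul]
  have htwo : ((2 : ℝ) • (1 : Matrix m m ℝ))⁻¹ = (2 : ℝ)⁻¹ • 1 :=
    inv_eq_right_inv (by simp)
  rw [hsmul, mul_inv_rev, mul_inv_rev, mul_inv_rev, htwo, Matrix.mul_smul, Matrix.mul_one,
    transpose_nonsing_inv, Matrix.mul_assoc]

end Matrix

/-- With `V, V₀` real symmetric, `V`, `R`, `L` invertible, `Σ` invertible symmetric,
`V − V₀ = 2LΣLᵀ` invertible, `J := RV(V−V₀)⁻¹`,
`V_σ := −V + (1/2) RV L⁻ᵀ Σ⁻¹ L⁻¹ V Rᵀ` and `A := L⁻¹J⁻¹L`, one has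
`(1/2) L⁻¹ J⁻¹ (V_σ + V₀) J⁻ᵀ L⁻ᵀ = Σ − A Σ Aᵀ`. -/
theorem half_conj_Vsigma_plus_V0_eq (n : ℕ)
    (V V₀ R L Sig : Matrix (Fin (2 * n)) (Fin (2 * n)) ℝ)
    (hVsymm : V.IsSymm) (hV₀symm : V₀.IsSymm)
    (hV : IsUnit V) (hR : IsUnit R) (hL : IsUnit L)
    (hSigSymm : Sig.IsSymm) (hSig : IsUnit Sig)
    (hLSig : V - V₀ = (2 : ℝ) • (L * Sig * Lᵀ))
    (hVV₀ : IsUnit (V - V₀))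
    (J Vσ A : Matrix (Fin (2 * n)) (Fin (2 * n)) ℝ)
    (hJ : J = R * V * (V - V₀)⁻¹)
    (hVσ : Vσ = -V + (2 : ℝ)⁻¹ • (R * V * (L⁻¹)ᵀ * Sig⁻¹ * L⁻¹ * V * Rᵀ))
    (hA : A = L⁻¹ * J⁻¹ * L) :
    (2 : ℝ)⁻¹ • (L⁻¹ * J⁻¹ * (Vσ + V₀) * (J⁻¹)ᵀ * (L⁻¹)ᵀ) =
      Sig - A * Sig * Aᵀ := by
  have hJunit : IsUnit J := by
    rw [hJ]
    exact (hR.mul hV).mul (isUnit_nonsing_inv_iff.mpr hVV₀)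
  have hLinv : L⁻¹ * L = 1 := nonsing_inv_mul L ((isUnit_iff_isUnit_det L).mp hL)
  have hLtranspose : Lᵀ * (L⁻¹)ᵀ = 1 := by rw [← transpose_mul, hLinv, transpose_one]
  have hWinv : (V - V₀)⁻¹ * (V - V₀) = 1 :=
    nonsing_inv_mul _ ((isUnit_iff_isUnit_det _).mp hVV₀)
  have hJtranspose : Jᵀ = (V - V₀)⁻¹ * (V * Rᵀ) := by
    rw [hJ, transpose_mul, transpose_mul, transpose_nonsing_inv, (hVsymm.sub hV₀symm).eq,
      hVsymm.eq]
  have hconj : J * (V - V₀) * Jᵀ =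
      (2 : ℝ)⁻¹ • (R * V * (L⁻¹)ᵀ * Sig⁻¹ * L⁻¹ * V * Rᵀ) := by
    calc J * (V - V₀) * Jᵀ
        = R * V * ((V - V₀)⁻¹ * (V - V₀)) * (V - V₀)⁻¹ * (V * Rᵀ) := by
          rw [hJtranspose, hJ]; simp only [Matrix.mul_assoc]
      _ = R * V * (V - V₀)⁻¹ * (V * Rᵀ) := by rw [hWinv, Matrix.mul_one]
      _ = _ := by
          rw [hLSig, inv_two_smul_conj_transpose, Matrix.mul_smul, Matrix.smul_mul]
          simp only [Matrix.mul_assoc]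
  have hsum : Vσ + V₀ = J * (V - V₀) * Jᵀ - (V - V₀) := by
    rw [hVσ, hconj]; abel
  calc (2 : ℝ)⁻¹ • (L⁻¹ * J⁻¹ * (Vσ + V₀) * (J⁻¹)ᵀ * (L⁻¹)ᵀ)
      = (2 : ℝ)⁻¹ •
          (L⁻¹ * (J⁻¹ * (J * (V - V₀) * Jᵀ - (V - V₀)) * (J⁻¹)ᵀ) * (L⁻¹)ᵀ) := by
        rw [hsum]; simp only [Matrix.mul_assoc]
    _ = (2 : ℝ)⁻¹ • (L⁻¹ * (V - V₀ - J⁻¹ * (V - V₀) * (J⁻¹)ᵀ) * (L⁻¹)ᵀ) := by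
        rw [inv_mul_conj_sub_mul_inv_transpose hJunit]
    _ = (L⁻¹ * L) * Sig * (Lᵀ * (L⁻¹)ᵀ) - A * Sig * Aᵀ := by
        rw [hLSig, hA]
        simp only [Matrix.mul_smul, Matrix.smul_mul, ← smul_sub, smul_smul, Matrix.mul_sub,
          Matrix.sub_mul, transpose_mul, Matrix.mul_assoc]
        norm_num
    _ = Sig - A * Sig * Aᵀ := by
        rw [hLinv, hLtranspose, Matrix.one_mul, Matrix.mul_one]
end
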